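/- Let μ be a Borel probability measure on ℝ with compact support that is absolutely continuous with respect to Lebesgue measure with density at most 1 almost everywhere, let E₋ and E₊ denote the infimum and supremum of supp μ, and set x₀ := E₊ + 4(E₊ − E₋). Write G(z) := ∫ (z − x)^{−1} dμ(x) and G′(z) := −∫ (z − x)^{−2} dμ(x) for real z > E₊. Let n be a natural number satisfying n·( 1 + (e^{G(x₀)} − 1)² / (e^{G(x₀)} · G′(x₀)) ) ≥ 1. Then there exists a unique ξ ∈ (E₊, ∞) such that n·(e^{G(ξ)} − 1)² + (n − 1)·e^{G(ξ)}·G′(ξ) = 0; moreover ξ ≥ x₀ (equivalently ξ − E₊ ≥ 4(E₊ − E₋)). -/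

import Mathlib

open MeasureTheory Filter Topology

noncomputable section

/-- The (topological) support of a measure on `ℝ`: the set of points all of whose open
neighborhoods have positive measure. -/
def msupp (μ : Measure ℝ) : Set ℝ :=
  {x : ℝ | ∀ U : Set ℝ, IsOpen U → x ∈ U → 0 < μ U}

/-- Power Cauchy moments. -/
def FF (μ : Measure ℝ) (m : ℕ) (z : ℝ) : ℝ := ∫ x, ((z - x) ^ m)⁻¹ ∂μ

lemma FF_integrable (μ : Measure ℝ) [IsProbabilityMeasure μ] {Em Ep : ℝ}
    (hae : ∀ᵐ x ∂μ, Em ≤ x ∧ x ≤ Ep) (m : ℕ) {z : ℝ} (hz : Ep < z) :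
    Integrable (fun x => ((z - x) ^ m)⁻¹) μ := by
  refine Integrable.of_bound (Measurable.aestronglyMeasurable (by fun_prop)) (((z - Ep) ^ m)⁻¹) ?_
  filter_upwards [hae] with x hx
  have h1 : 0 < z - Ep := by linarith
  have h2 : 0 < z - x := by linarith [hx.2]
  rw [Real.norm_of_nonneg (by positivity)]
  have h3 : z - Ep ≤ z - x := by linarith [hx.2]
  gcongr

lemma FF_bounds (μ : Measure ℝ) [IsProbabilityMeasure μ] {Em Ep : ℝ}
    (hae : ∀ᵐ x ∂μ, Em ≤ x ∧ x ≤ Ep) (m : ℕ) {z : ℝ} (hz : Ep < z) :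
    ((z - Em) ^ m)⁻¹ ≤ FF μ m z ∧ FF μ m z ≤ ((z - Ep) ^ m)⁻¹ := by
  have hi := FF_integrable μ hae m hz
  constructor
  · have := integral_mono_ae (μ := μ) (f := fun _ => ((z - Em) ^ m)⁻¹) (integrable_const _) hi (by
      filter_upwards [hae] with x hx
      have h2 : 0 < z - x := by linarith [hx.2]
      have h3 : z - x ≤ z - Em := by linarith [hx.1]
      gcongr)
    simpa [FF] using this
  · have := integral_mono_ae (μ := μ) (g := fun _ => ((z - Ep) ^ m)⁻¹) hi (integrable_const _) (by
      filter_upwards [hae] with x hx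
      have h2 : 0 < z - Ep := by linarith [hx.2]
      have h3 : z - Ep ≤ z - x := by linarith [hx.2]
      gcongr)
    simpa [FF] using this

lemma FF_hasDerivAt (μ : Measure ℝ) [IsProbabilityMeasure μ] {Em Ep : ℝ}
    (hae : ∀ᵐ x ∂μ, Em ≤ x ∧ x ≤ Ep) (m : ℕ) {z : ℝ} (hz : Ep < z) :
    HasDerivAt (FF μ m) (-(m * FF μ (m + 1) z)) z := by
  obtain ⟨c, hc1, hc2⟩ := exists_between hz
  have key := hasDerivAt_integral_of_dominated_loc_of_deriv_le (μ := μ) (s := Set.Ioi c)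
    (F := fun z x => ((z - x) ^ m)⁻¹) (x₀ := z)
    (F' := fun z x => -(m * ((z - x) ^ (m + 1))⁻¹))
    (bound := fun _ => m * ((c - Ep) ^ (m + 1))⁻¹) (Ioi_mem_nhds hc2)
    (Eventually.of_forall fun z => Measurable.aestronglyMeasurable (by fun_prop))
    (FF_integrable μ hae m hz) (Measurable.aestronglyMeasurable (by fun_prop))
    (by
      filter_upwards [hae] with x hx y hy
      have hy' : c < y := hy
      have h1 : 0 < c - Ep := by linarith
      have h3 : c - Ep ≤ y - x := by linarith [hx.2]
      have h2 : 0 < y - x := by linarith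
      rw [norm_neg, Real.norm_of_nonneg (by positivity)]
      gcongr)
    (integrable_const _)
    (by
      filter_upwards [hae] with x hx y hy
      have hy' : c < y := hy
      have h2 : 0 < y - x := by linarith [hx.2]
      have h : HasDerivAt (fun y => ((y - x) ^ m)⁻¹)
          (-(m * (y - x) ^ (m - 1) * 1) / ((y - x) ^ m) ^ 2) y :=
        (((hasDerivAt_id y).sub_const x).pow m).inv (pow_pos h2 m).ne'
      refine h.congr_deriv ?_
      rcases m with _ | m
      · simp
      · simp only [Nat.add_sub_cancel]
        field_simp
        ring)
  have h2 := key.2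
  rw [integral_neg, integral_const_mul] at h2
  exact h2

/-- The bathtub inequality. -/
lemma bathtub (μ : Measure ℝ) [IsProbabilityMeasure μ] {Em Ep : ℝ}
    (hae : ∀ᵐ x ∂μ, Em ≤ x ∧ x ≤ Ep) (hle : μ ≤ volume) {z : ℝ} (hz : Ep < z)
    {p q : ℝ} (hp : 0 < p) (hpq : p < q) (h1 : Real.log q - Real.log p = FF μ 1 z)
    (h2 : q - p = FF μ 2 z) :
    (q ^ 2 - p ^ 2) / 2 ≤ FF μ 3 z ∧ (FF μ 3 z = (q ^ 2 - p ^ 2) / 2 → p⁻¹ - q⁻¹ = 1) := by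
  have hq : 0 < q := hp.trans hpq
  set a := z - p⁻¹ with ha
  set b := z - q⁻¹ with hb
  have hab : a < b := by
    have : q⁻¹ < p⁻¹ := by gcongr
    linarith
  have hbz : b < z := by have := inv_pos.2 hq; linarith
  set k : ℝ → ℝ := fun x => (z - x)⁻¹ * ((z - x)⁻¹ - p) * ((z - x)⁻¹ - q) with hk
  have hkm : Measurable k := by fun_prop
  have hkexp : ∀ x, k x = ((z - x) ^ 3)⁻¹ - (p + q) * ((z - x) ^ 2)⁻¹
      + p * q * ((z - x) ^ 1)⁻¹ := by
    intro x; simp only [hk, ← inv_pow]; ring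
  have i1 := FF_integrable μ hae 1 hz
  have i2 := FF_integrable μ hae 2 hz
  have i3 := FF_integrable μ hae 3 hz
  have hki : Integrable k μ := by
    rw [show k = _ from funext hkexp]
    exact (i3.sub (i2.const_mul _)).add (i1.const_mul _)
  have hkμ : ∫ x, k x ∂μ = FF μ 3 z - (p + q) * FF μ 2 z + p * q * FF μ 1 z := by
    simp_rw [hkexp]
    have j : Integrable (fun x => ((z - x) ^ 3)⁻¹ - (p + q) * ((z - x) ^ 2)⁻¹) μ :=
      i3.sub (i2.const_mul _)
    rw [integral_add j (i1.const_mul _),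
      integral_sub i3 (i2.const_mul _), integral_const_mul, integral_const_mul]
    rfl
  -- signs
  have slt : ∀ x, x < z → (x < a ↔ (z - x)⁻¹ < p) ∧ (a < x ↔ p < (z - x)⁻¹) ∧
      (x < b ↔ (z - x)⁻¹ < q) ∧ (b < x ↔ q < (z - x)⁻¹) := by
    intro x hx
    have hx' : 0 < z - x := by linarith
    rw [inv_lt_comm₀ hx' hp, lt_inv_comm₀ hp hx', inv_lt_comm₀ hx' hq, lt_inv_comm₀ hq hx']
    refine ⟨⟨?_, ?_⟩, ⟨?_, ?_⟩, ⟨?_, ?_⟩, ⟨?_, ?_⟩⟩ <;> intro h <;> linarith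
  have kin : ∀ x ∈ Set.Ioo a b, k x < 0 := by
    intro x hx
    have hxz : x < z := hx.2.trans hbz
    obtain ⟨_, s2, s3, _⟩ := slt x hxz
    have hx' : 0 < (z - x)⁻¹ := inv_pos.2 (by linarith)
    exact mul_neg_of_pos_of_neg (mul_pos hx' (sub_pos.2 (s2.1 hx.1))) (sub_neg.2 (s3.1 hx.2))
  have kl : ∀ x, x < a → 0 < k x := by
    intro x hx
    have hxz : x < z := by linarith
    have hx' : 0 < (z - x)⁻¹ := inv_pos.2 (by linarith)
    obtain ⟨s1, s2, s3, s4⟩ := slt x hxz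
    exact mul_pos_of_neg_of_neg (mul_neg_of_pos_of_neg hx' (sub_neg.2 (s1.1 hx)))
      (sub_neg.2 (s3.1 (hx.trans hab)))
  have kr : ∀ x, b < x → x < z → 0 < k x := by
    intro x hx hxz
    have hx' : 0 < (z - x)⁻¹ := inv_pos.2 (by linarith)
    obtain ⟨s1, s2, s3, s4⟩ := slt x hxz
    exact mul_pos (mul_pos hx' (sub_pos.2 (s2.1 (hab.trans hx)))) (sub_pos.2 (s4.1 hx))
  have hac : μ ≪ volume := Measure.absolutelyContinuous_of_le hle
  have hna : ∀ᵐ x ∂μ, x ≠ a := hac.ae_le (Measure.ae_ne volume a)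
  have hnb : ∀ᵐ x ∂μ, x ≠ b := hac.ae_le (Measure.ae_ne volume b)
  have kout : ∀ᵐ x ∂(μ.restrict (Set.Ioo a b)ᶜ), 0 < k x := by
    rw [ae_restrict_iff' measurableSet_Ioo.compl]
    filter_upwards [hae, hna, hnb] with x hx hxa hxb hxI
    rcases lt_or_gt_of_ne hxa with h | h
    · exact kl x h
    · rcases lt_or_gt_of_ne hxb with h' | h'
      · exact absurd ⟨h, h'⟩ hxI
      · exact kr x h' (by linarith [hx.2])
  have hsplit : ∫ x in Set.Ioo a b, k x ∂μ + ∫ x in (Set.Ioo a b)ᶜ, k x ∂μ = ∫ x, k x ∂μ :=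
    integral_add_compl measurableSet_Ioo hki
  have hout : 0 ≤ ∫ x in (Set.Ioo a b)ᶜ, k x ∂μ :=
    integral_nonneg_of_ae (kout.mono fun x hx => hx.le)
  -- the Lebesgue integral
  have hcont : ContinuousOn k (Set.uIcc a b) := by
    rw [Set.uIcc_of_le hab.le]
    have : ∀ x ∈ Set.Icc a b, z - x ≠ 0 := fun x hx => by
      have := hx.2; intro h; linarith
    fun_prop (disch := assumption)
  have hkint : IntervalIntegrable k volume a b := hcont.intervalIntegrable
  have hleb : ∫ x in Set.Ioo a b, k x = (q ^ 2 - p ^ 2) / 2 - (p + q) * (q - p)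
      + p * q * (Real.log q - Real.log p) := by
    rw [← integral_Ioc_eq_integral_Ioo, ← intervalIntegral.integral_of_le hab.le]
    rw [intervalIntegral.integral_eq_sub_of_hasDerivAt (f := fun x => ((z - x)⁻¹) ^ 2 / 2
      - (p + q) * (z - x)⁻¹ - p * q * Real.log (z - x)) _ hkint]
    · simp only [ha, hb, sub_sub_cancel, inv_inv, Real.log_inv]; ring
    · intro x hx
      rw [Set.uIcc_of_le hab.le] at hx
      have hx' : z - x ≠ 0 := by have := hx.2; intro h; linarith
      have d0 : HasDerivAt (fun x => z - x) (-1) x := by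
        simpa using (hasDerivAt_id x).const_sub z
      have d1 : HasDerivAt (fun x => (z - x)⁻¹) (- -1 / (z - x) ^ 2) x := d0.inv hx'
      have d2 := d0.log hx'
      have := (((d1.pow 2).div_const 2).sub (d1.const_mul (p + q))).sub (d2.const_mul (p * q))
      refine HasDerivAt.congr_deriv (f' := _) this ?_
      simp only [hk, Nat.add_one_sub_one, pow_one, Nat.cast_ofNat]
      field_simp
      ring
  set lam := (volume : Measure ℝ).restrict (Set.Ioo a b) - μ.restrict (Set.Ioo a b) with hlam
  have hadd : lam + μ.restrict (Set.Ioo a b) = volume.restrict (Set.Ioo a b) :=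
    Measure.sub_add_cancel_of_le (Measure.restrict_mono_measure hle _)
  have hll : lam ≤ volume.restrict (Set.Ioo a b) := Measure.sub_le
  have hkv : Integrable k (volume.restrict (Set.Ioo a b)) :=
    ((intervalIntegrable_iff_integrableOn_Ioo_of_le hab.le).1 hkint)
  have hkl : Integrable k lam := hkv.mono_measure hll
  have hin : ∫ x, k x ∂lam + ∫ x in Set.Ioo a b, k x ∂μ = ∫ x in Set.Ioo a b, k x := by
    rw [← integral_add_measure hkl hki.restrict, hadd]
  have klam : ∀ᵐ x ∂lam, k x < 0 :=
    (Measure.absolutelyContinuous_of_le hll).ae_le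
      ((ae_restrict_iff' measurableSet_Ioo).2 (Eventually.of_forall kin))
  have hlamneg : 0 ≤ ∫ x, -k x ∂lam :=
    integral_nonneg_of_ae (klam.mono fun x hx => by simpa using hx.le)
  rw [integral_neg] at hlamneg
  rw [h1, h2] at hleb
  refine ⟨by linarith, fun heq => ?_⟩
  have e1 : ∫ x in (Set.Ioo a b)ᶜ, k x ∂μ = 0 := by linarith
  have e2 : ∫ x, -k x ∂lam = 0 := by rw [integral_neg]; linarith
  rw [integral_eq_zero_iff_of_nonneg_ae (kout.mono fun x hx => hx.le) hki.restrict] at e1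
  replace e2 := (integral_eq_zero_iff_of_nonneg_ae (f := fun x => -k x)
    (klam.mono fun x hx => by simpa using hx.le) hkl.neg).1 e2
  have f1 : μ (Set.Ioo a b)ᶜ = 0 := by
    have : ∀ᵐ x ∂(μ.restrict (Set.Ioo a b)ᶜ), False := by
      filter_upwards [e1, kout] with x hx hx'
      simp only [Pi.zero_apply] at hx
      linarith
    have h0 := ae_iff.1 this
    simpa only [not_false_eq_true, Set.setOf_true, Measure.restrict_apply_univ] using h0
  have f2 : lam = 0 := by
    have : ∀ᵐ x ∂lam, False := by
      filter_upwards [e2, klam] with x hx hx'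
      simp only [Pi.zero_apply] at hx
      linarith
    simpa using this
  have f3 : μ (Set.Ioo a b) = 1 := by
    rwa [prob_compl_eq_zero_iff measurableSet_Ioo] at f1
  rw [f2, zero_add] at hadd
  have f4 := congrArg (fun ν => ν Set.univ) hadd
  simp only [Measure.restrict_apply_univ, f3, Real.volume_Ioo] at f4
  have f5 : b - a = 1 := by
    have := congrArg ENNReal.toReal f4
    rw [ENNReal.toReal_ofReal (by linarith)] at this
    simpa using this.symm
  rw [← f5, ha, hb]; ring

/-- The ratio function. -/
def hh (μ : Measure ℝ) (z : ℝ) : ℝ :=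
  (Real.exp (FF μ 1 z) - 1) ^ 2 / (Real.exp (FF μ 1 z) * FF μ 2 z)

lemma FF_pos (μ : Measure ℝ) [IsProbabilityMeasure μ] {Em Ep : ℝ} (hE : Em < Ep)
    (hae : ∀ᵐ x ∂μ, Em ≤ x ∧ x ≤ Ep) (m : ℕ) {z : ℝ} (hz : Ep < z) : 0 < FF μ m z := by
  have h : 0 < z - Em := by linarith
  exact lt_of_lt_of_le (by positivity) (FF_bounds μ hae m hz).1

lemma hh_deriv (μ : Measure ℝ) [IsProbabilityMeasure μ] {Em Ep : ℝ} (hE : Em < Ep)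
    (hae : ∀ᵐ x ∂μ, Em ≤ x ∧ x ≤ Ep) (hle : μ ≤ volume) {z : ℝ} (hz : Ep < z) :
    ∃ D, HasDerivAt (hh μ) D z ∧ 0 ≤ D ∧ (D = 0 → hh μ z = 1) := by
  have p1 := FF_pos μ hE hae 1 hz
  have p2 := FF_pos μ hE hae 2 hz
  have d1 := FF_hasDerivAt μ hae 1 hz
  have d2 := FF_hasDerivAt μ hae 2 hz
  norm_num at d1 d2
  have hE1 : 1 < Real.exp (FF μ 1 z) := by simpa using p1
  have dE := d1.exp
  have dh := ((dE.sub_const 1).pow 2).div (dE.mul d2)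
    (mul_pos (Real.exp_pos _) p2).ne'
  refine ⟨_, dh, ?_⟩
  have hbt := bathtub μ hae hle hz (p := FF μ 2 z / (Real.exp (FF μ 1 z) - 1))
    (q := FF μ 2 z / (Real.exp (FF μ 1 z) - 1) * Real.exp (FF μ 1 z))
    (div_pos p2 (by linarith))
    (by have : 0 < FF μ 2 z / (Real.exp (FF μ 1 z) - 1) := div_pos p2 (by linarith)
        nlinarith)
    (by have : 0 < FF μ 2 z / (Real.exp (FF μ 1 z) - 1) := div_pos p2 (by linarith)
        rw [Real.log_mul this.ne' (by positivity), Real.log_exp]; ring)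
    (by have : Real.exp (FF μ 1 z) - 1 ≠ 0 := by linarith
        field_simp)
  simp only [hh, Pi.mul_apply, Pi.pow_apply]
  generalize Real.exp (FF μ 1 z) = E at *
  generalize FF μ 2 z = A at *
  generalize FF μ 3 z = B at *
  have hEp : 0 < E - 1 := by linarith
  have hE0 : 0 < E := by linarith
  have hsq : ((A / (E - 1) * E) ^ 2 - (A / (E - 1)) ^ 2) / 2 = (E + 1) * A ^ 2 / (2 * (E - 1)) := by
    field_simp; ring
  rw [hsq] at hbt
  obtain ⟨b1, b2⟩ := hbt
  have hD : ∀ X : ℝ, X = (E * (E - 1) * (2 * (E - 1)) * (B - (E + 1) * A ^ 2 / (2 * (E - 1))))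
      / (E * A) ^ 2 → 0 ≤ X ∧ (X = 0 → (E - 1) ^ 2 / (E * A) = 1) := by
    rintro X rfl
    refine ⟨div_nonneg (mul_nonneg (by positivity) (by linarith)) (by positivity), fun h => ?_⟩
    have hB : B - (E + 1) * A ^ 2 / (2 * (E - 1)) = 0 := by
      rcases div_eq_zero_iff.1 h with h | h
      · rcases mul_eq_zero.1 h with h | h
        · exact absurd h (by positivity)
        · exact h
      · exact absurd h (by positivity)
    have b3 := b2 (by linarith)
    refine Eq.trans ?_ b3
    field_simp
  apply hD
  field_simp
  ring

lemma hh_lower (μ : Measure ℝ) [IsProbabilityMeasure μ] {Em Ep : ℝ} (hE : Em < Ep)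
    (hae : ∀ᵐ x ∂μ, Em ≤ x ∧ x ≤ Ep) {z : ℝ} (hz : Ep < z) :
    ((z - Ep) / (z - Em)) ^ 2 ≤ hh μ z := by
  have p1 := FF_pos μ hE hae 1 hz
  have p2 := FF_pos μ hE hae 2 hz
  have b1 := (FF_bounds μ hae 1 hz).1
  have b2 := (FF_bounds μ hae 2 hz).2
  unfold hh
  generalize FF μ 1 z = G at *
  generalize FF μ 2 z = A at *
  have hs : G / 2 ≤ Real.sinh (G / 2) := Real.self_le_sinh_iff.2 (by linarith)
  rw [Real.sinh_eq] at hs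
  have he : Real.exp G = Real.exp (G / 2) ^ 2 := by rw [← Real.exp_nat_mul]; congr 1; push_cast; ring
  have hc : Real.exp (G / 2) * Real.exp (-(G / 2)) = 1 := by rw [← Real.exp_add]; simp
  have e0 := Real.exp_pos (G / 2)
  have key : G * Real.exp (G / 2) ≤ Real.exp G - 1 := by
    rw [he]; nlinarith
  have key2 : G ^ 2 * Real.exp G ≤ (Real.exp G - 1) ^ 2 := by
    calc G ^ 2 * Real.exp G = (G * Real.exp (G / 2)) ^ 2 := by rw [he]; ring
      _ ≤ _ := by gcongr
  have hzm : 0 < z - Em := by linarith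
  have hzp : 0 < z - Ep := by linarith
  rw [pow_one] at b1
  rw [le_div_iff₀ (by positivity)]
  have k3 : ((z - Ep) / (z - Em)) ^ 2 * A ≤ G ^ 2 := by
    calc ((z - Ep) / (z - Em)) ^ 2 * A ≤ ((z - Ep) / (z - Em)) ^ 2 * ((z - Ep) ^ 2)⁻¹ := by gcongr
      _ = ((z - Em)⁻¹) ^ 2 := by field_simp
      _ ≤ G ^ 2 := by gcongr
  calc _ = ((z - Ep) / (z - Em)) ^ 2 * A * Real.exp G := by ring
    _ ≤ G ^ 2 * Real.exp G := by gcongr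
    _ ≤ _ := key2

lemma supp_facts (μ : Measure ℝ) [IsProbabilityMeasure μ]
    (hcompact : IsCompact (msupp μ)) (hac : μ ≪ (volume : Measure ℝ)) :
    (∀ᵐ x ∂μ, sInf (msupp μ) ≤ x ∧ x ≤ sSup (msupp μ)) ∧ sInf (msupp μ) < sSup (msupp μ) := by
  have hs : msupp μ = μ.support := by
    ext x
    rw [Measure.mem_support_iff_forall]
    constructor
    · intro h U hU
      obtain ⟨V, hVU, hV, hxV⟩ := mem_nhds_iff.1 hU
      exact (h V hV hxV).trans_le (measure_mono hVU)
    · intro h U hU hx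
      exact h U (hU.mem_nhds hx)
  have hmem : ∀ᵐ x ∂μ, x ∈ msupp μ := by rw [hs]; exact Measure.support_mem_ae
  have hb : ∀ᵐ x ∂μ, sInf (msupp μ) ≤ x ∧ x ≤ sSup (msupp μ) := by
    filter_upwards [hmem] with x hx
    exact ⟨csInf_le hcompact.bddBelow hx, le_csSup hcompact.bddAbove hx⟩
  refine ⟨hb, ?_⟩
  by_contra hcon
  have hne : ∀ᵐ x ∂μ, x ≠ sSup (msupp μ) := hac.ae_le (Measure.ae_ne volume _)
  obtain ⟨x, hx, hx'⟩ := (hb.and hne).exists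
  exact hx' (le_antisymm hx.2 (by linarith [hx.1]))

lemma le_vol (μ : Measure ℝ) [IsProbabilityMeasure μ] (hac : μ ≪ (volume : Measure ℝ))
    (hdens : ∀ᵐ x ∂(volume : Measure ℝ), μ.rnDeriv volume x ≤ 1) : μ ≤ volume := by
  rw [← Measure.withDensity_rnDeriv_eq μ volume hac]
  calc _ ≤ (volume : Measure ℝ).withDensity 1 := withDensity_mono hdens
    _ = volume := withDensity_one

/-- Quantized analogue of Statement 15.  Let `μ` be a compactly
supported probability measure on `ℝ`, absolutely continuous with respect to Lebesgue
measure with density at most `1` almost everywhere, `x₀ := E₊ + 4(E₊ − E₋)`,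
`G(z) := ∫ (z−x)⁻¹ dμ`, `G′(z) := −∫ (z−x)⁻² dμ`.  If `n ∈ ℕ` satisfies
`n (1 + (e^{G(x₀)} − 1)²/(e^{G(x₀)} G′(x₀))) ≥ 1`, then there is a unique
`ξ ∈ (E₊, ∞)` with `n (e^{G(ξ)} − 1)² + (n−1) e^{G(ξ)} G′(ξ) = 0`; moreover `ξ ≥ x₀`. -/
theorem statement16 (μ : Measure ℝ) [IsProbabilityMeasure μ]
    (hcompact : IsCompact (msupp μ))
    (hac : μ ≪ (volume : Measure ℝ))
    (hdens : ∀ᵐ x ∂(volume : Measure ℝ), μ.rnDeriv volume x ≤ 1) :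
    let Em : ℝ := sInf (msupp μ)
    let Ep : ℝ := sSup (msupp μ)
    let x₀ : ℝ := Ep + 4 * (Ep - Em)
    let G : ℝ → ℝ := fun z => ∫ x, (z - x)⁻¹ ∂μ
    let G' : ℝ → ℝ := fun z => -∫ x, ((z - x) ^ 2)⁻¹ ∂μ
    ∀ n : ℕ,
      1 ≤ (n : ℝ) * (1 + (Real.exp (G x₀) - 1) ^ 2 / (Real.exp (G x₀) * G' x₀)) →
        ∃ ξ : ℝ, ξ ∈ Set.Ioi Ep ∧
          (n : ℝ) * (Real.exp (G ξ) - 1) ^ 2 +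
            ((n : ℝ) - 1) * Real.exp (G ξ) * G' ξ = 0 ∧
          (∀ ξ' ∈ Set.Ioi Ep,
            (n : ℝ) * (Real.exp (G ξ') - 1) ^ 2 +
              ((n : ℝ) - 1) * Real.exp (G ξ') * G' ξ' = 0 → ξ' = ξ) ∧
          x₀ ≤ ξ := by
  intro Em Ep x₀ G G' n hn
  obtain ⟨hae, hE⟩ := supp_facts μ hcompact hac
  have hle := le_vol μ hac hdens
  change ∀ᵐ x ∂μ, Em ≤ x ∧ x ≤ Ep at hae
  change Em < Ep at hE
  have hG : ∀ z, G z = FF μ 1 z := fun z => by simp [G, FF]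
  have hG' : ∀ z, G' z = -FF μ 2 z := fun z => rfl
  have hx₀ : Ep < x₀ := by simp only [x₀]; linarith
  have hpos : ∀ z, Ep < z → 0 < hh μ z := by
    intro z hz
    have p1 := FF_pos μ hE hae 1 hz
    have p2 := FF_pos μ hE hae 2 hz
    have hE1 : 0 < Real.exp (FF μ 1 z) - 1 := by simpa using p1
    unfold hh
    positivity
  have hn' : 1 ≤ (n : ℝ) * (1 - hh μ x₀) := by
    rw [hG, hG', mul_neg, div_neg, ← sub_eq_add_neg] at hn
    exact hn
  have h0 := hpos x₀ hx₀
  have hn0 : (0 : ℝ) < n := by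
    rcases Nat.eq_zero_or_pos n with h | h
    · subst h; norm_num at hn'
    · exact_mod_cast h
  have hn2 : (2 : ℝ) ≤ n := by
    have : (1 : ℝ) < n := by nlinarith
    exact_mod_cast this
  have hiff : ∀ z, Ep < z → ((n : ℝ) * (Real.exp (G z) - 1) ^ 2 +
            ((n : ℝ) - 1) * Real.exp (G z) * G' z = 0 ↔ hh μ z = 1 - 1 / n) := by
    intro z hz
    have p2 := FF_pos μ hE hae 2 hz
    have e := Real.exp_pos (FF μ 1 z)
    rw [hG, hG', hh, div_eq_iff (by positivity)]
    constructor
    · intro h; field_simp; linarith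
    · intro h; rw [h]; field_simp; ring
  choose! D hD using fun z (hz : Ep < z) => hh_deriv μ hE hae hle hz
  have hcont : ContinuousOn (hh μ) (Set.Ioi Ep) := fun z hz =>
    (hD z hz).1.continuousAt.continuousWithinAt
  have hmono : MonotoneOn (hh μ) (Set.Ioi Ep) := by
    apply monotoneOn_of_deriv_nonneg (convex_Ioi _) hcont
    · rw [interior_Ioi]
      exact fun z hz => (hD z hz).1.differentiableAt.differentiableWithinAt
    · rw [interior_Ioi]
      intro z hz
      rw [(hD z hz).1.deriv]
      exact (hD z hz).2.1
  have hc1 : 1 - 1 / (n : ℝ) < 1 := by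
    have : 0 < 1 / (n : ℝ) := by positivity
    linarith
  -- uniqueness
  have huniq : ∀ u v, Ep < u → u < v → hh μ u = 1 - 1 / n → hh μ v = 1 - 1 / n → False := by
    intro u v hu huv h1 h2
    obtain ⟨w, hw1, hw2⟩ := exists_between huv
    have hc : ∀ y ∈ Set.Ioo u v, hh μ y = 1 - 1 / n := by
      intro y hy
      have hyE : Ep < y := hu.trans hy.1
      exact le_antisymm (h2 ▸ hmono hyE (hyE.trans hy.2) hy.2.le)
        (h1 ▸ hmono hu hyE hy.1.le)
    have hd : HasDerivAt (hh μ) 0 w := by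
      refine (hasDerivAt_const w (1 - 1 / (n : ℝ))).congr_of_eventuallyEq ?_
      filter_upwards [Ioo_mem_nhds hw1 hw2] with y hy using hc y hy
    have hwE : Ep < w := hu.trans hw1
    have := (hD w hwE).2.2 ((hD w hwE).1.unique hd)
    rw [hc w ⟨hw1, hw2⟩] at this
    linarith
  -- existence
  set z₁ := Ep + 2 * (Ep - Em) * n with hz₁
  have hz01 : x₀ ≤ z₁ := by simp only [hz₁, x₀]; nlinarith
  have hz1 : Ep < z₁ := lt_of_lt_of_le hx₀ hz01
  have hup : 1 - 1 / (n : ℝ) ≤ hh μ z₁ := by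
    refine le_trans ?_ (hh_lower μ hE hae hz1)
    have hd : 0 < Ep - Em := by linarith
    have e : (z₁ - Ep) / (z₁ - Em) = 1 - 1 / (2 * n + 1) := by
      have h1 : z₁ - Ep = (Ep - Em) * (2 * n) := by rw [hz₁]; ring
      have h2 : z₁ - Em = (Ep - Em) * (2 * n + 1) := by rw [hz₁]; ring
      rw [h1, h2]
      field_simp
      ring
    rw [e]
    have : 2 * (1 / (2 * (n : ℝ) + 1)) ≤ 1 / n := by
      rw [← mul_div_assoc, div_le_div_iff₀ (by positivity) hn0]; linarith
    nlinarith [sq_nonneg (1 / (2 * (n : ℝ) + 1))]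
  have hlow : hh μ x₀ ≤ 1 - 1 / n := by
    have : 1 / (n : ℝ) ≤ 1 - hh μ x₀ := by
      rw [div_le_iff₀ hn0]; linarith
    linarith
  obtain ⟨ξ, hξ, hξe⟩ := intermediate_value_Icc hz01
    (hcont.mono fun y hy => lt_of_lt_of_le hx₀ hy.1) ⟨hlow, hup⟩
  have hξE : Ep < ξ := lt_of_lt_of_le hx₀ hξ.1
  refine ⟨ξ, hξE, (hiff ξ hξE).2 hξe, ?_, hξ.1⟩
  intro ξ' hξ' h
  have h' := (hiff ξ' hξ').1 h
  rcases lt_trichotomy ξ' ξ with hlt | heq | hgt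
  · exact (huniq _ _ hξ' hlt h' hξe).elim
  · exact heq
  · exact (huniq _ _ hξE hgt hξe h').elim
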